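/- Let C ⊆ ℝ^d be a full-dimensional polytope with 0 in its interior and let P ⊆ ℝ^d be a nonempty compact convex set. If P ⊆ C and P intersects every facet of C (i.e. P ∩ F ≠ ∅ for every (d−1)-dimensional face F of C), then P is optimally contained in C. -/

import Mathlib

open Set Pointwise

/-- `P` is optimally contained in `C`: `P ⊆ C` and no smaller homothetic copy of `C` contains `P`. -/
def OptimallyContained {d : ℕ} (P C : Set (EuclideanSpace ℝ (Fin d))) : Prop :=
  P ⊆ C ∧ ¬ ∃ (c : EuclideanSpace ℝ (Fin d)) (ρ : ℝ), 0 ≤ ρ ∧ ρ < 1 ∧ P ⊆ c +ᵥ ρ • C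

/-- A facet of a full-dimensional polytope `C ⊆ ℝ^d`: an exposed face of dimension `d - 1`. -/
def IsFacet {d : ℕ} (C F : Set (EuclideanSpace ℝ (Fin d))) : Prop :=
  IsExposed ℝ C F ∧ Module.finrank ℝ (affineSpan ℝ F).direction = d - 1

open Topology Filter in
theorem exists_perturb {d : ℕ} (V : Finset (EuclideanSpace ℝ (Fin d)))
    (a w : EuclideanSpace ℝ (Fin d)) (ha : ∀ v ∈ V, inner ℝ a v ≤ 1)
    (hw : ∀ v ∈ V, inner ℝ a v = 1 → inner ℝ w v = 0) :
    ∃ ε : ℝ, 0 < ε ∧ (∀ v ∈ V, inner ℝ (a + ε • w) v ≤ 1) ∧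
      (∀ v ∈ V, inner ℝ (a - ε • w) v ≤ 1) := by
  have h : ∀ᶠ ε : ℝ in 𝓝 0, ∀ v ∈ V, inner ℝ (a + ε • w) v ≤ 1 := by
    rw [Filter.eventually_all_finset]
    intro v hv
    rcases eq_or_lt_of_le (ha v hv) with h1 | h1
    · refine Eventually.of_forall fun ε => ?_
      rw [inner_add_left, real_inner_smul_left, hw v hv h1, h1]
      simp
    · have hc : Continuous fun ε : ℝ => inner ℝ (a + ε • w) v := by fun_prop
      have : Tendsto (fun ε : ℝ => inner ℝ (a + ε • w) v) (𝓝 0) (𝓝 (inner ℝ a v)) := by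
        simpa using hc.tendsto 0
      filter_upwards [this.eventually_lt_const h1] with ε hε using hε.le
  obtain ⟨δ, hδ, H⟩ := Metric.eventually_nhds_iff.1 h
  refine ⟨δ / 2, by positivity, H ?_, ?_⟩
  · rw [Real.dist_eq, sub_zero, abs_of_pos (by positivity)]; linarith
  · have := @H (-(δ / 2)) (by
      rw [Real.dist_eq, sub_zero, abs_neg, abs_of_pos (by positivity)]; linarith)
    simpa [sub_eq_add_neg] using this

theorem span_active {d : ℕ} (V : Finset (EuclideanSpace ℝ (Fin d)))
    (a : EuclideanSpace ℝ (Fin d))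
    (ha : a ∈ extremePoints ℝ {a : EuclideanSpace ℝ (Fin d) | ∀ v ∈ V, inner ℝ a v ≤ 1}) :
    Submodule.span ℝ {v | v ∈ V ∧ inner ℝ a v = 1} = ⊤ := by
  by_contra hne
  have hbot : (Submodule.span ℝ {v | v ∈ V ∧ inner ℝ a v = 1})ᗮ ≠ ⊥ := fun h =>
    hne ((Submodule.orthogonal_eq_bot_iff).1 h)
  obtain ⟨w, hw, hw0⟩ := Submodule.exists_mem_ne_zero_of_ne_bot hbot
  obtain ⟨ε, hε, h1, h2⟩ := exists_perturb V a w ha.1 (fun v hv hav =>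
    (Submodule.mem_orthogonal' _ w).1 hw v (Submodule.subset_span ⟨hv, hav⟩))
  have := ha.2 h1 h2 ⟨1/2, 1/2, by norm_num, by norm_num, by norm_num, by module⟩
  have h3 : ε • w = 0 := by simpa using this
  rcases smul_eq_zero.1 h3 with h | h
  · exact hε.ne' h
  · exact hw0 h

theorem le_one_on {d : ℕ} (V : Finset (EuclideanSpace ℝ (Fin d)))
    (a : EuclideanSpace ℝ (Fin d)) (ha : ∀ v ∈ V, inner ℝ a v ≤ 1)
    (x : EuclideanSpace ℝ (Fin d))
    (hx : x ∈ convexHull ℝ (V : Set (EuclideanSpace ℝ (Fin d)))) : inner ℝ a x ≤ 1 := by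
  have hc : Convex ℝ {x : EuclideanSpace ℝ (Fin d) | inner ℝ a x ≤ 1} :=
    convex_halfSpace_le (innerSL ℝ a).toLinearMap.isLinear 1
  exact convexHull_min (fun v hv => ha v hv) hc hx

theorem polar_compact {d : ℕ} (V : Finset (EuclideanSpace ℝ (Fin d)))
    (h0 : (0 : EuclideanSpace ℝ (Fin d)) ∈
      interior (convexHull ℝ (V : Set (EuclideanSpace ℝ (Fin d))))) :
    IsCompact {a : EuclideanSpace ℝ (Fin d) | ∀ v ∈ V, inner ℝ a v ≤ 1} := by
  obtain ⟨r, hr, hball⟩ := Metric.mem_nhds_iff.1 (mem_interior_iff_mem_nhds.1 h0)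
  refine Metric.isCompact_of_isClosed_isBounded ?_ ?_
  · simp only [Set.ofPred_forall]
    exact isClosed_iInter fun v => isClosed_iInter fun _ =>
      isClosed_le (by fun_prop) continuous_const
  · refine (Metric.isBounded_closedBall (x := 0) (r := 2 / r)).subset fun a ha => ?_
    rw [mem_closedBall_zero_iff]
    rcases eq_or_ne a 0 with rfl | hne
    · simp; positivity
    have hn : 0 < ‖a‖ := norm_pos_iff.2 hne
    have := le_one_on V a ha ((r / 2 / ‖a‖) • a) (hball (by
      rw [mem_ball_zero_iff, norm_smul, Real.norm_of_nonneg (by positivity),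
        div_mul_cancel₀ _ hn.ne']
      linarith))
    rw [real_inner_smul_right, real_inner_self_eq_norm_sq] at this
    have h2 : r / 2 / ‖a‖ * ‖a‖ ^ 2 = r / 2 * ‖a‖ := by field_simp
    rw [h2] at this
    rw [le_div_iff₀ hr]
    linarith

theorem exists_facet {d : ℕ} (hd : d ≠ 0) (V : Finset (EuclideanSpace ℝ (Fin d)))
    (h0 : (0 : EuclideanSpace ℝ (Fin d)) ∈
      interior (convexHull ℝ (V : Set (EuclideanSpace ℝ (Fin d)))))
    (c : EuclideanSpace ℝ (Fin d)) :
    ∃ a : EuclideanSpace ℝ (Fin d), ∃ F, inner ℝ a c ≤ 0 ∧ (∀ v ∈ V, inner ℝ a v ≤ 1) ∧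
      IsFacet (convexHull ℝ (V : Set (EuclideanSpace ℝ (Fin d)))) F ∧
      ∀ x ∈ F, inner ℝ a x = 1 := by
  set C := convexHull ℝ (V : Set (EuclideanSpace ℝ (Fin d))) with hC
  set K := {a : EuclideanSpace ℝ (Fin d) | ∀ v ∈ V, inner ℝ a v ≤ 1} with hK
  have hKc : IsCompact K := polar_compact V h0
  have h0K : (0 : EuclideanSpace ℝ (Fin d)) ∈ K := fun v _ => by simp
  let l : StrongDual ℝ (EuclideanSpace ℝ (Fin d)) := innerSL ℝ (-c)
  have hexp : IsExposed ℝ K (l.toExposed K) := ContinuousLinearMap.toExposed.isExposed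
  have hne : (l.toExposed K).Nonempty := by
    obtain ⟨x, hx, hmax⟩ := hKc.exists_isMaxOn ⟨0, h0K⟩ l.continuous.continuousOn
    exact ⟨x, hx, fun y hy => hmax hy⟩
  obtain ⟨a, ha⟩ := (hexp.isCompact hKc).extremePoints_nonempty hne
  have haK : a ∈ extremePoints ℝ K := hexp.isExtreme.extremePoints_subset_extremePoints ha
  have hac : inner ℝ a c ≤ 0 := by
    have := ha.1.2 0 h0K
    simp only [l, innerSL_apply_apply, inner_zero_right, inner_neg_left] at this
    rw [real_inner_comm] 
    linarith
  have hspan := span_active V a haK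
  have hle : ∀ x ∈ C, inner ℝ a x ≤ 1 := le_one_on V a haK.1
  obtain ⟨x0, hx0V, hx0⟩ : ∃ v, v ∈ V ∧ inner ℝ a v = 1 := by
    by_contra hcon
    have : {v | v ∈ V ∧ inner ℝ a v = 1} = ∅ := by
      ext v; simp only [mem_ofPred_eq, mem_empty_iff_false, iff_false]
      exact fun h => hcon ⟨v, h⟩
    rw [this, Submodule.span_empty] at hspan
    have h := congrArg (fun S : Submodule ℝ (EuclideanSpace ℝ (Fin d)) => Module.finrank ℝ S) hspan
    simp at h
    exact hd h.symm
  have hVC : ∀ v ∈ V, v ∈ C := fun v hv => subset_convexHull ℝ _ hv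
  set F := (innerSL ℝ a : StrongDual ℝ (EuclideanSpace ℝ (Fin d))).toExposed C with hF
  have hF1 : ∀ x ∈ F, inner ℝ a x = 1 := by
    intro x hx
    have h := hx.2 x0 (hVC x0 hx0V)
    simp only [innerSL_apply_apply] at h
    exact le_antisymm (hle x hx.1) (hx0 ▸ h)
  have hFm : ∀ v ∈ V, inner ℝ a v = 1 → v ∈ F := by
    intro v hv h1
    refine ⟨hVC v hv, fun y hy => ?_⟩
    simp only [innerSL_apply_apply, h1]
    exact hle y hy
  refine ⟨a, F, hac, haK.1, ⟨ContinuousLinearMap.toExposed.isExposed, ?_⟩, hF1⟩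
  set D := (affineSpan ℝ F).direction with hD
  have hDv : D = vectorSpan ℝ F := direction_affineSpan ℝ F
  have hx0F := hFm x0 hx0V hx0
  have hup : Module.finrank ℝ D < d := by
    have hlt : D < ⊤ := by
      refine lt_top_iff_ne_top.2 fun htop => ?_
      have hDker : D ≤ LinearMap.ker (innerSL ℝ a).toLinearMap := by
        rw [hDv, vectorSpan_def, Submodule.span_le]
        rintro _ ⟨x, hx, y, hy, rfl⟩
        simp [inner_sub_right, hF1 x hx, hF1 y hy]
      have : x0 ∈ D := htop ▸ Submodule.mem_top
      have h := hDker this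
      simp [hx0] at h
    have := Submodule.finrank_lt hlt.ne
    simpa using this
  have hlow : d ≤ Module.finrank ℝ D + 1 := by
    have hsup : D ⊔ Submodule.span ℝ {x0} = ⊤ := by
      rw [eq_top_iff, ← hspan, Submodule.span_le]
      rintro v ⟨hv, h1⟩
      have h2 : v - x0 ∈ D := by
        rw [hDv]; exact vsub_mem_vectorSpan ℝ (hFm v hv h1) hx0F
      have := Submodule.add_mem_sup h2 (Submodule.mem_span_singleton_self (R := ℝ) x0)
      simpa using this
    have h1 := Submodule.finrank_add_le_finrank_add_finrank D (Submodule.span ℝ {x0})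
    rw [hsup] at h1
    have h2 : Module.finrank ℝ (Submodule.span ℝ {x0}) ≤ 1 := by
      simpa using finrank_span_le_card (R := ℝ) ({x0} : Set (EuclideanSpace ℝ (Fin d)))
    simp at h1
    omega
  omega

theorem touching_facets_optimal {d : ℕ} (C P : Set (EuclideanSpace ℝ (Fin d)))
    (V : Finset (EuclideanSpace ℝ (Fin d))) (hCpoly : C = convexHull ℝ (V : Set (EuclideanSpace ℝ (Fin d))))
    (hC0 : (0 : EuclideanSpace ℝ (Fin d)) ∈ interior C)
    (hPne : P.Nonempty) (hPcomp : IsCompact P) (hPconv : Convex ℝ P)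
    (hPC : P ⊆ C)
    (hTouch : ∀ F : Set (EuclideanSpace ℝ (Fin d)), IsFacet C F → (P ∩ F).Nonempty) :
    OptimallyContained P C := by
  refine ⟨hPC, ?_⟩
  rintro ⟨c, ρ, hρ0, hρ1, hsub⟩
  rcases eq_or_ne d 0 with rfl | hd
  · have : IsFacet C (∅ : Set (EuclideanSpace ℝ (Fin 0))) :=
      ⟨fun h => absurd h (by simp), by simp⟩
    obtain ⟨x, -, hx⟩ := hTouch _ this
    exact hx
  subst hCpoly
  obtain ⟨a, F, hac, haV, hFacet, hF1⟩ := exists_facet hd V hC0 c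
  obtain ⟨p, hpP, hpF⟩ := hTouch F hFacet
  obtain ⟨q, ⟨y, hy, rfl⟩, hq⟩ := hsub hpP
  have h1 := hF1 p hpF
  have h2 := le_one_on V a haV y hy
  rw [← hq] at h1
  simp only [vadd_eq_add, inner_add_right, real_inner_smul_right] at h1
  nlinarith
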